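/- Fix Γ > 0, μ > 0 and δ ∈ [0, 4/5]. The pointwise Hessian of φ_δ is also its distributional Hessian: for every test function χ ∈ C_c^∞(ℝ³; ℝ) and all i, j ∈ {1,2,3}, one has ∫_{ℝ³} φ_δ(x) ∂_i ∂_j χ(x) dx = ∫_{ℝ³} ∂_i ∂_j φ_δ(x) χ(x) dx, both integrals being absolutely convergent; in particular the second distributional derivatives of φ_δ carry no singular part at the origin. -/

import Mathlib

open MeasureTheory Real

noncomputable section

abbrev E3 := EuclideanSpace ℝ (Fin 3)

/-- The de-singularised potential `φ_δ(z) = Γ / √(|z|² + μ² |z|^δ)`. -/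
noncomputable def phi (Γ μ δ : ℝ) (z : E3) : ℝ :=
  Γ / Real.sqrt (‖z‖ ^ 2 + μ ^ 2 * ‖z‖ ^ δ)

/-- `A(r) = r² + μ² r^δ`. -/
noncomputable def Afun (μ δ r : ℝ) : ℝ := r ^ 2 + μ ^ 2 * r ^ δ

/-- `B(r) = 2 + δ μ² r^{δ−2}`. -/
noncomputable def Bfun (μ δ r : ℝ) : ℝ := 2 + δ * μ ^ 2 * r ^ (δ - 2)

/-- The pointwise Hessian of `φ_δ`:
`∇∇φ_δ(z) = −(Γ/2) A(|z|)^{−3/2} [ B(|z|) Id + δ(δ−2) μ² |z|^{δ−4} z ⊗ z ]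
            + (3Γ/4) A(|z|)^{−5/2} B(|z|)² z ⊗ z`. -/
noncomputable def hessPhi (Γ μ δ : ℝ) (z : E3) : Matrix (Fin 3) (Fin 3) ℝ :=
  Matrix.of fun i j =>
    -(Γ / 2) * Afun μ δ ‖z‖ ^ (-(3 : ℝ) / 2) *
      (Bfun μ δ ‖z‖ * (if i = j then (1 : ℝ) else 0) +
        δ * (δ - 2) * μ ^ 2 * ‖z‖ ^ (δ - 4) * (z i * z j)) +
    3 * Γ / 4 * Afun μ δ ‖z‖ ^ (-(5 : ℝ) / 2) * Bfun μ δ ‖z‖ ^ 2 * (z i * z j)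

/-- The standard basis vector `eᵢ` of `ℝ³`. -/
noncomputable def e3 (i : Fin 3) : E3 := EuclideanSpace.single i (1 : ℝ)

section IntegrationByParts

lemma deriv_smoothTransition_of_notMem_Icc {t : ℝ} (ht : t ∉ Set.Icc (0 : ℝ) 1) :
    deriv smoothTransition t = 0 := by
  rw [Set.mem_Icc, not_and_or, not_le, not_le] at ht
  rcases ht with ht | ht
  · have h : smoothTransition =ᶠ[nhds t] fun _ => (0 : ℝ) := by
      filter_upwards [gt_mem_nhds ht] with s hs using smoothTransition.zero_of_nonpos hs.le
    simpa using h.deriv_eq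
  · have h : smoothTransition =ᶠ[nhds t] fun _ => (1 : ℝ) := by
      filter_upwards [lt_mem_nhds ht] with s hs using smoothTransition.one_of_one_le hs.le
    simpa using h.deriv_eq

lemma exists_abs_deriv_smoothTransition_mul_le :
    ∃ M, ∀ t : ℝ, |deriv smoothTransition t * (t + 1)| ≤ M := by
  have hc : Continuous (deriv smoothTransition) :=
    (smoothTransition.contDiff (n := 1)).continuous_deriv le_rfl
  refine (hc.mul (continuous_id.add continuous_const)).bounded_above_of_compact_support
    (HasCompactSupport.intro (isCompact_Icc (a := (0 : ℝ)) (b := 1)) fun t ht => ?_)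
  simp [deriv_smoothTransition_of_notMem_Icc ht]

variable {E : Type*} [NormedAddCommGroup E] [InnerProductSpace ℝ E]

/-- A smooth cutoff vanishing near the origin and equal to `1` where `2 ≤ c * ‖x‖ ^ 2`. -/
def originCutoff (c : ℝ) (x : E) : ℝ := smoothTransition (c * ‖x‖ ^ 2 - 1)

lemma contDiff_originCutoff (c : ℝ) : ContDiff ℝ 1 (originCutoff c : E → ℝ) :=
  smoothTransition.contDiff.comp
    ((contDiff_const.mul (contDiff_norm_sq ℝ)).sub contDiff_const)

lemma fderiv_originCutoff (c : ℝ) (x v : E) :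
    fderiv ℝ (originCutoff c) x v =
      deriv smoothTransition (c * ‖x‖ ^ 2 - 1) * (c * (2 * inner ℝ x v)) := by
  have hS : HasDerivAt smoothTransition (deriv smoothTransition (c * ‖x‖ ^ 2 - 1))
      (c * ‖x‖ ^ 2 - 1) :=
    ((smoothTransition.contDiff (n := 1)).differentiable one_ne_zero _).hasDerivAt
  have hq : HasFDerivAt (fun y : E => c * ‖y‖ ^ 2 - 1) (c • (2 • innerSL ℝ x)) x :=
    ((hasStrictFDerivAt_norm_sq x).hasFDerivAt.const_mul c).sub_const 1
  have h := hS.comp_hasFDerivAt x hq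
  have h' : fderiv ℝ (originCutoff c) x = _ := h.fderiv
  rw [h']
  simp

lemma exists_abs_fderiv_originCutoff_le :
    ∃ M, ∀ c : ℝ, ∀ x v : E, |fderiv ℝ (originCutoff c) x v| ≤ M * ‖v‖ * ‖x‖⁻¹ := by
  obtain ⟨M, hM⟩ := exists_abs_deriv_smoothTransition_mul_le
  refine ⟨2 * M, fun c x v => ?_⟩
  rw [fderiv_originCutoff]
  rcases eq_or_ne x 0 with rfl | hx
  · simp
  have hx' : 0 < ‖x‖ := norm_pos_iff.2 hx
  have h1 := hM (c * ‖x‖ ^ 2 - 1)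
  have h2 : |inner ℝ x v| ≤ ‖x‖ * ‖v‖ := abs_real_inner_le_norm x v
  set D := deriv smoothTransition (c * ‖x‖ ^ 2 - 1)
  have h3 : D * (c * (2 * inner ℝ x v)) =
      2 * (D * (c * ‖x‖ ^ 2 - 1 + 1)) * (inner ℝ x v / ‖x‖ ^ 2) := by
    field_simp
    ring
  rw [h3, abs_mul, abs_mul, abs_two, abs_div, abs_of_pos (pow_pos hx' 2)]
  have h4 : |inner ℝ x v| / ‖x‖ ^ 2 ≤ ‖v‖ * ‖x‖⁻¹ := by
    rw [div_le_iff₀ (pow_pos hx' 2)]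
    calc _ ≤ _ := h2
      _ = _ := by field_simp
  have hM0 : 0 ≤ M := (abs_nonneg _).trans h1
  calc _ ≤ 2 * M * (‖v‖ * ‖x‖⁻¹) := by gcongr
    _ = _ := by ring

variable [FiniteDimensional ℝ E] [Nontrivial E] [MeasurableSpace E] [BorelSpace E]

/-- Integration by parts for a function with a singularity at the origin that is mild enough for
`f / ‖x‖` to be locally integrable. -/
theorem integral_mul_fderiv_eq_neg_of_hasLineDerivAt_off_zero
    {ν : Measure E} [ν.IsAddHaarMeasure] {f g χ : E → ℝ} {v : E}
    (hf : LocallyIntegrable f ν) (hf' : LocallyIntegrable (fun x => f x * ‖x‖⁻¹) ν)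
    (hg : LocallyIntegrable g ν) (hfg : ∀ x ≠ 0, HasLineDerivAt ℝ f (g x) x v)
    (hχ : ContDiff ℝ 1 χ) (hχs : HasCompactSupport χ) :
    ∫ x, f x * fderiv ℝ χ x v ∂ν = -∫ x, g x * χ x ∂ν := by
  have int_mul {h k : E → ℝ} (hh : LocallyIntegrable h ν) (hk : Continuous k)
      (hks : HasCompactSupport k) : Integrable (fun x => h x * k x) ν := by
    simpa using hh.integrable_smul_right_of_hasCompactSupport hk hks
  have cont_fderiv {k : E → ℝ} (hk : ContDiff ℝ 1 k) : Continuous fun x => fderiv ℝ k x v :=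
    (hk.continuous_fderiv one_ne_zero).clm_apply continuous_const
  have supp_fderiv {k : E → ℝ} (hk : HasCompactSupport k) :
      HasCompactSupport fun x => fderiv ℝ k x v :=
    hk.fderiv_apply ℝ v
  obtain ⟨M, hM⟩ := exists_abs_fderiv_originCutoff_le (E := E)
  let c : ℕ → ℝ := fun n => n + 1
  let ψ : ℕ → E → ℝ := fun n x => originCutoff (c n) x * χ x
  have hψ (n) : ContDiff ℝ 1 (ψ n) := (contDiff_originCutoff _).mul hχ
  have hψs (n) : HasCompactSupport (ψ n) := hχs.mul_left
  have hψ0 (n) : (0 : E) ∉ tsupport (ψ n) := by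
    rw [notMem_tsupport_iff_eventuallyEq]
    have : ∀ᶠ x : E in nhds 0, c n * ‖x‖ ^ 2 - 1 < 0 := by
      have hc : Continuous fun x : E => c n * ‖x‖ ^ 2 - 1 := by fun_prop
      exact hc.continuousAt.eventually_lt continuousAt_const (by simp)
    filter_upwards [this] with x hx
    simp [ψ, originCutoff, smoothTransition.zero_of_nonpos hx.le]
  have i1 (n) := int_mul hf (cont_fderiv (hψ n)) (supp_fderiv (hψs n))
  have i2 (n) := int_mul hg (hψ n).continuous (hψs n)
  have j1 := int_mul hf (cont_fderiv hχ) (supp_fderiv hχs)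
  have j2 := int_mul hg hχ.continuous hχs
  have j3 := int_mul hf' hχ.continuous hχs
  have parts (n) : ∫ x, (f x * fderiv ℝ (ψ n) x v + g x * ψ n x) ∂ν = 0 := by
    have := integral_bilinear_hasLineDerivAt_right_eq_neg_left_of_integrable (μ := ν)
      (B := ContinuousLinearMap.mul ℝ ℝ) (v := v) (f := f) (f' := g) (g := ψ n)
      (g' := fun x => fderiv ℝ (ψ n) x v) (i2 n) (i1 n)
      (int_mul hf (hψ n).continuous (hψs n))
      (fun x hx => hfg x fun h => hψ0 n (h ▸ hx))
      (fun x _ => ((hψ n).differentiable one_ne_zero x).hasFDerivAt.hasLineDerivAt v)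
    simp only [ContinuousLinearMap.mul_apply'] at this
    rw [integral_add (i1 n) (i2 n), this, neg_add_cancel]
  have fderiv_ψ (n x) : fderiv ℝ (ψ n) x v =
      originCutoff (c n) x * fderiv ℝ χ x v + χ x * fderiv ℝ (originCutoff (c n)) x v := by
    have h := ((contDiff_originCutoff (c n)).differentiable one_ne_zero x).hasFDerivAt.mul
      (hχ.differentiable one_ne_zero x).hasFDerivAt
    have h' : fderiv ℝ (ψ n) x = _ := h.fderiv
    rw [h']
    simp
  have lim := tendsto_integral_of_dominated_convergence (μ := ν)
    (F := fun (n : ℕ) x => f x * fderiv ℝ (ψ n) x v + g x * ψ n x)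
    (f := fun x => f x * fderiv ℝ χ x v + g x * χ x)
    (fun x => |f x * fderiv ℝ χ x v| + |g x * χ x| + M * ‖v‖ * |f x * ‖x‖⁻¹ * χ x|)
    (fun n => ((i1 n).add (i2 n)).aestronglyMeasurable)
    ((j1.abs.add j2.abs).add (j3.abs.const_mul _))
    (fun n => ae_of_all _ fun x => ?_)
    ?_
  · simp only [parts] at lim
    have := tendsto_nhds_unique lim tendsto_const_nhds
    rw [integral_add j1 j2] at this
    linarith
  · have h0 : |originCutoff (c n) x| ≤ 1 := by
      rw [originCutoff, abs_of_nonneg (smoothTransition.nonneg _)]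
      exact smoothTransition.le_one _
    have hD := hM (c n) x v
    rw [fderiv_ψ, Real.norm_eq_abs]
    have e : f x * (originCutoff (c n) x * fderiv ℝ χ x v +
          χ x * fderiv ℝ (originCutoff (c n)) x v) + g x * ψ n x =
        originCutoff (c n) x * (f x * fderiv ℝ χ x v) + originCutoff (c n) x * (g x * χ x) +
          fderiv ℝ (originCutoff (c n)) x v * (f x * χ x) := by
      simp only [ψ]; ring
    rw [e]
    refine (abs_add_three _ _ _).trans ?_
    rw [abs_mul, abs_mul (originCutoff (c n) x), abs_mul (fderiv ℝ (originCutoff (c n)) x v)]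
    gcongr ?_ + ?_ + ?_
    · exact mul_le_of_le_one_left (abs_nonneg _) h0
    · exact mul_le_of_le_one_left (abs_nonneg _) h0
    · calc _ ≤ M * ‖v‖ * ‖x‖⁻¹ * |f x * χ x| := by gcongr
        _ = _ := by
          rw [abs_mul, abs_mul, abs_mul, abs_of_nonneg (inv_nonneg.2 (norm_nonneg x))]; ring
  · filter_upwards [Measure.ae_ne ν 0] with x hx
    have hx' : 0 < ‖x‖ ^ 2 := by positivity
    have ht : Filter.Tendsto (fun n => c n * ‖x‖ ^ 2 - 1) Filter.atTop Filter.atTop :=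
      Filter.tendsto_atTop_add_const_right _ _
        ((Filter.tendsto_atTop_add_const_right _ 1 tendsto_natCast_atTop_atTop).atTop_mul_const hx')
    refine tendsto_const_nhds.congr' ?_
    filter_upwards [ht.eventually_gt_atTop 1] with n hn
    have h1 : originCutoff (c n) x = 1 := smoothTransition.one_of_one_le hn.le
    have h2 : fderiv ℝ (originCutoff (c n)) x v = 0 := by
      rw [fderiv_originCutoff, deriv_smoothTransition_of_notMem_Icc (fun h => hn.not_ge h.2),
        zero_mul]
    simp only [fderiv_ψ, h1, h2, ψ]
    ring

end IntegrationByParts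

section RadialDerivatives

lemma hasLineDerivAt_comp_norm {E : Type*} [NormedAddCommGroup E]
    [InnerProductSpace ℝ E] {F : ℝ → ℝ} {F' : ℝ} {x : E} (hF : HasDerivAt F F' ‖x‖) (hx : x ≠ 0)
    (v : E) : HasLineDerivAt ℝ (fun y => F ‖y‖) (F' * (inner ℝ x v / ‖x‖)) x v := by
  have h1 : HasDerivAt (fun t : ℝ => x + t • v) v 0 := by
    simpa using ((hasDerivAt_id (0 : ℝ)).smul_const v).const_add x
  have h2 := h1.norm_sq.sqrt (by simpa using hx)
  have h3 : HasDerivAt (fun t : ℝ => ‖x + t • v‖) (inner ℝ x v / ‖x‖) 0 := by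
    convert! h2 using 1
    · ext t
      simp
    · simp
      ring
  exact hF.comp_of_eq 0 h3 (by simp)

variable {Γ μ δ r : ℝ}

lemma Afun_pos (hμ : 0 < μ) (hr : 0 < r) : 0 < Afun μ δ r := by
  unfold Afun; positivity

lemma hasDerivAt_Afun (hr : 0 < r) : HasDerivAt (Afun μ δ) (Bfun μ δ r * r) r := by
  have h := (hasDerivAt_pow 2 r).add
    ((hasDerivAt_rpow_const (p := δ) (Or.inl hr.ne')).const_mul (μ ^ 2))
  convert! h using 1
  have : r ^ (δ - 1) = r ^ (δ - 2) * r := by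
    rw [← rpow_add_one hr.ne']; ring_nf
  rw [Bfun, this]
  push_cast
  ring

lemma hasDerivAt_Bfun (hr : 0 < r) :
    HasDerivAt (Bfun μ δ) (δ * (δ - 2) * μ ^ 2 * r ^ (δ - 4) * r) r := by
  have h := ((hasDerivAt_rpow_const (p := δ - 2) (Or.inl hr.ne')).const_mul (δ * μ ^ 2)).const_add 2
  convert! h using 1
  have : r ^ (δ - 2 - 1) = r ^ (δ - 4) * r := by
    rw [← rpow_add_one hr.ne']; ring_nf
  rw [this]
  ring

lemma hasDerivAt_Afun_rpow (hμ : 0 < μ) (hr : 0 < r) (p : ℝ) :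
    HasDerivAt (fun s => Afun μ δ s ^ p) (p * Afun μ δ r ^ (p - 1) * (Bfun μ δ r * r)) r := by
  convert! (hasDerivAt_Afun hr).rpow_const (p := p) (Or.inl (Afun_pos (δ := δ) hμ hr).ne') using 1
  ring

lemma phi_eq_mul_rpow (Γ μ δ : ℝ) (x : E3) : phi Γ μ δ x = Γ * Afun μ δ ‖x‖ ^ (-(1 : ℝ) / 2) := by
  have : 0 ≤ Afun μ δ ‖x‖ := by unfold Afun; positivity
  rw [neg_div, rpow_neg this, ← sqrt_eq_rpow, ← div_eq_mul_inv]
  rfl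

/-- The pointwise gradient of `phi`. -/
def gradPhi (Γ μ δ : ℝ) (x : E3) (i : Fin 3) : ℝ :=
  -(Γ / 2) * Afun μ δ ‖x‖ ^ (-(3 : ℝ) / 2) * Bfun μ δ ‖x‖ * x i

lemma inner_e3 (x : E3) (i : Fin 3) : inner ℝ x (e3 i) = x i := by
  simp [e3, EuclideanSpace.inner_single_right]

lemma hasLineDerivAt_phi (hμ : 0 < μ) {x : E3} (hx : x ≠ 0) (i : Fin 3) :
    HasLineDerivAt ℝ (phi Γ μ δ) (gradPhi Γ μ δ x i) x (e3 i) := by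
  have hr : 0 < ‖x‖ := norm_pos_iff.2 hx
  have h := hasLineDerivAt_comp_norm
    ((hasDerivAt_Afun_rpow (δ := δ) hμ hr (-(1 : ℝ) / 2)).const_mul Γ) hx (e3 i)
  rw [inner_e3] at h
  convert! h using 1
  · ext y
    exact phi_eq_mul_rpow Γ μ δ y
  · rw [gradPhi, show -(1 : ℝ) / 2 - 1 = -3 / 2 by norm_num]
    field_simp

lemma hasLineDerivAt_gradPhi (hμ : 0 < μ) {x : E3} (hx : x ≠ 0) (i j : Fin 3) :
    HasLineDerivAt ℝ (fun y => gradPhi Γ μ δ y i) (hessPhi Γ μ δ x i j) x (e3 j) := by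
  have hr : 0 < ‖x‖ := norm_pos_iff.2 hx
  have h1 := hasLineDerivAt_comp_norm
    (((hasDerivAt_Afun_rpow (δ := δ) hμ hr (-(3 : ℝ) / 2)).const_mul (-(Γ / 2))).mul
      (hasDerivAt_Bfun (μ := μ) (δ := δ) hr)) hx (e3 j)
  have h2 : HasDerivAt (fun t : ℝ => (x + t • e3 j) i) (if i = j then 1 else 0) 0 := by
    have := ((hasDerivAt_id (0 : ℝ)).mul_const (if i = j then (1 : ℝ) else 0)).const_add (x i)
    simpa [e3] using this
  rw [inner_e3] at h1
  have h3 := HasDerivAt.mul h1 h2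
  unfold HasLineDerivAt
  convert! h3 using 1
  simp only [hessPhi, Matrix.of_apply, Pi.mul_apply, zero_smul, add_zero]
  rw [show -(3 : ℝ) / 2 - 1 = -5 / 2 by norm_num]
  field_simp
  ring

end RadialDerivatives

section Bounds

variable {Γ μ δ r : ℝ}

lemma Afun_rpow_neg_half_le (hμ : 0 < μ) (hr : 0 < r) :
    Afun μ δ r ^ (-(1 : ℝ) / 2) ≤ μ⁻¹ * r ^ (-(δ / 2)) := by
  have h : (μ ^ 2 * r ^ δ) ^ (-(1 : ℝ) / 2) = μ⁻¹ * r ^ (-(δ / 2)) := by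
    rw [mul_rpow (by positivity) (by positivity), ← rpow_mul hr.le, ← rpow_natCast,
      ← rpow_mul hμ.le, ← rpow_neg_one]
    congr 2 <;> push_cast <;> ring
  rw [← h]
  refine rpow_le_rpow_of_nonpos (by positivity) ?_ (by norm_num)
  unfold Afun
  nlinarith [sq_nonneg r]

lemma Afun_rpow_neg_three_halves (hμ : 0 < μ) (hr : 0 < r) :
    Afun μ δ r ^ (-(3 : ℝ) / 2) = Afun μ δ r ^ (-(1 : ℝ) / 2) / Afun μ δ r := by
  rw [← rpow_sub_one (Afun_pos hμ hr).ne']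
  norm_num

lemma Afun_rpow_neg_five_halves (hμ : 0 < μ) (hr : 0 < r) :
    Afun μ δ r ^ (-(5 : ℝ) / 2) = Afun μ δ r ^ (-(1 : ℝ) / 2) / Afun μ δ r ^ 2 := by
  rw [← rpow_sub_natCast (Afun_pos hμ hr).ne']
  norm_num

lemma Bfun_nonneg (hδ : 0 ≤ δ) (hr : 0 < r) : 0 ≤ Bfun μ δ r := by
  unfold Bfun; positivity

lemma Bfun_div_Afun_le (hμ : 0 < μ) (hδ : δ ≤ 2) (hr : 0 < r) :
    Bfun μ δ r / Afun μ δ r ≤ 2 / r ^ 2 := by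
  rw [div_le_div_iff₀ (Afun_pos hμ hr) (by positivity)]
  have h : r ^ (δ - 2) * r ^ 2 = r ^ δ := by
    rw [← rpow_add_natCast hr.ne']; norm_num
  have h' : 0 ≤ (2 - δ) * (μ ^ 2 * r ^ δ) := mul_nonneg (sub_nonneg.2 hδ) (by positivity)
  unfold Bfun Afun
  linear_combination h' + δ * μ ^ 2 * h

lemma rpow_sub_four_div_Afun_le (hμ : 0 < μ) (hr : 0 < r) :
    μ ^ 2 * r ^ (δ - 4) / Afun μ δ r ≤ 1 / r ^ 4 := by
  rw [div_le_div_iff₀ (Afun_pos hμ hr) (by positivity)]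
  have h : r ^ (δ - 4) * r ^ 4 = r ^ δ := by
    rw [← rpow_add_natCast hr.ne']; norm_num
  unfold Afun
  nlinarith [h, sq_nonneg r]

lemma abs_gradPhi_le (hΓ : 0 ≤ Γ) (hμ : 0 < μ) (hδ : δ ∈ Set.Icc (0 : ℝ) 2) {x : E3} (hx : x ≠ 0)
    (i : Fin 3) :
    |gradPhi Γ μ δ x i| ≤ Γ * Afun μ δ ‖x‖ ^ (-(1 : ℝ) / 2) * ‖x‖⁻¹ := by
  have hr : 0 < ‖x‖ := norm_pos_iff.2 hx
  have hA := Afun_pos (δ := δ) hμ hr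
  have hB := Bfun_div_Afun_le hμ hδ.2 hr
  have hB0 := Bfun_nonneg (μ := μ) hδ.1 hr
  have hi : |x i| ≤ ‖x‖ := PiLp.norm_apply_le x i
  have e : gradPhi Γ μ δ x i = -(Γ / 2 * Afun μ δ ‖x‖ ^ (-(1 : ℝ) / 2) *
      (Bfun μ δ ‖x‖ / Afun μ δ ‖x‖) * x i) := by
    rw [gradPhi, Afun_rpow_neg_three_halves hμ hr]
    ring
  rw [e, abs_neg, abs_mul, abs_of_nonneg (by positivity)]
  calc _ ≤ Γ / 2 * Afun μ δ ‖x‖ ^ (-(1 : ℝ) / 2) * (2 / ‖x‖ ^ 2) * ‖x‖ := by gcongr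
    _ = _ := by field_simp

lemma abs_hessPhi_le (hΓ : 0 ≤ Γ) (hμ : 0 < μ) (hδ : δ ∈ Set.Icc (0 : ℝ) 2) {x : E3} (hx : x ≠ 0)
    (i j : Fin 3) :
    |hessPhi Γ μ δ x i j| ≤ 6 * Γ * Afun μ δ ‖x‖ ^ (-(1 : ℝ) / 2) * (‖x‖ ^ 2)⁻¹ := by
  have hr : 0 < ‖x‖ := norm_pos_iff.2 hx
  have hA := Afun_pos (δ := δ) hμ hr
  have hB := Bfun_div_Afun_le hμ hδ.2 hr
  have hB0 := Bfun_nonneg (μ := μ) hδ.1 hr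
  have hR := rpow_sub_four_div_Afun_le (δ := δ) hμ hr
  have hi : |x i| ≤ ‖x‖ := PiLp.norm_apply_le x i
  have hj : |x j| ≤ ‖x‖ := PiLp.norm_apply_le x j
  have hδ1 : |δ * (δ - 2)| ≤ 2 := by
    rw [abs_le]
    constructor <;> nlinarith [hδ.1, hδ.2]
  have hk : |if i = j then (1 : ℝ) else 0| ≤ 1 := by split_ifs <;> simp
  have e : hessPhi Γ μ δ x i j =
      -(Γ / 2 * Afun μ δ ‖x‖ ^ (-(1 : ℝ) / 2)) *
        (Bfun μ δ ‖x‖ / Afun μ δ ‖x‖) * (if i = j then (1 : ℝ) else 0) +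
      -(Γ / 2 * Afun μ δ ‖x‖ ^ (-(1 : ℝ) / 2)) * (μ ^ 2 * ‖x‖ ^ (δ - 4) / Afun μ δ ‖x‖) *
        (δ * (δ - 2) * (x i * x j)) +
      3 * Γ / 4 * Afun μ δ ‖x‖ ^ (-(1 : ℝ) / 2) *
        (Bfun μ δ ‖x‖ / Afun μ δ ‖x‖) ^ 2 * (x i * x j) := by
    rw [hessPhi, Matrix.of_apply, Afun_rpow_neg_three_halves hμ hr,
      Afun_rpow_neg_five_halves hμ hr]
    ring
  rw [e]
  set P := Afun μ δ ‖x‖ ^ (-(1 : ℝ) / 2)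
  have hP0 : 0 ≤ P := by positivity
  have hQ0 : 0 ≤ Bfun μ δ ‖x‖ / Afun μ δ ‖x‖ := by positivity
  have hR0 : 0 ≤ μ ^ 2 * ‖x‖ ^ (δ - 4) / Afun μ δ ‖x‖ := by positivity
  set Q := Bfun μ δ ‖x‖ / Afun μ δ ‖x‖
  set R := μ ^ 2 * ‖x‖ ^ (δ - 4) / Afun μ δ ‖x‖
  refine (abs_add_three _ _ _).trans ?_
  simp only [abs_mul _ (if i = j then (1 : ℝ) else 0), abs_mul _ (δ * (δ - 2) * (x i * x j)),
    abs_mul _ (x i * x j), abs_mul (x i), neg_mul, abs_neg]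
  rw [abs_of_nonneg (by positivity : 0 ≤ Γ / 2 * P * Q),
    abs_of_nonneg (by positivity : 0 ≤ Γ / 2 * P * R),
    abs_of_nonneg (by positivity : 0 ≤ 3 * Γ / 4 * P * Q ^ 2)]
  calc _ ≤ Γ / 2 * P * (2 / ‖x‖ ^ 2) * 1 + Γ / 2 * P * (1 / ‖x‖ ^ 4) * (2 * (‖x‖ * ‖x‖)) +
        3 * Γ / 4 * P * (2 / ‖x‖ ^ 2) ^ 2 * (‖x‖ * ‖x‖) := by gcongr
    _ = 5 * Γ * P * (‖x‖ ^ 2)⁻¹ := by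
      field_simp
      ring
    _ ≤ _ := by gcongr; norm_num

lemma locallyIntegrable_of_abs_le_Afun_rpow (hμ : 0 < μ) {h : E3 → ℝ} {C : ℝ} {k : ℕ}
    (hC : 0 ≤ C) (hk : δ / 2 + k < 3) (hm : Measurable h)
    (hb : ∀ x ≠ 0, |h x| ≤ C * Afun μ δ ‖x‖ ^ (-(1 : ℝ) / 2) * (‖x‖ ^ k)⁻¹) :
    LocallyIntegrable h := by
  refine locallyIntegrable_of_norm_le_rpow (C := C * μ⁻¹) (α := δ / 2 + k) (by simp) (by simpa)
    ?_ hm.aestronglyMeasurable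
  filter_upwards [Measure.ae_ne volume 0] with x hx
  have hr : 0 < ‖x‖ := norm_pos_iff.2 hx
  refine (hb x hx).trans ?_
  calc _ ≤ C * (μ⁻¹ * ‖x‖ ^ (-(δ / 2))) * (‖x‖ ^ k)⁻¹ := by
        gcongr
        exact Afun_rpow_neg_half_le hμ hr
    _ = _ := by
      rw [neg_add, rpow_add hr, rpow_neg hr.le (k : ℝ), rpow_natCast]
      ring

lemma measurable_phi : Measurable (phi Γ μ δ) := by
  unfold phi; fun_prop

lemma measurable_gradPhi (i : Fin 3) : Measurable fun x => gradPhi Γ μ δ x i := by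
  unfold gradPhi Afun Bfun; fun_prop

lemma measurable_hessPhi (i j : Fin 3) : Measurable fun x => hessPhi Γ μ δ x i j := by
  simp only [hessPhi, Matrix.of_apply, Afun, Bfun]; fun_prop

end Bounds

theorem stmt6 (Γ μ δ : ℝ) (hΓ : 0 < Γ) (hμ : 0 < μ) (hδ : δ ∈ Set.Icc (0 : ℝ) (4 / 5))
    (χ : E3 → ℝ) (hχ : ContDiff ℝ (⊤ : ℕ∞) χ) (hχsupp : HasCompactSupport χ) (i j : Fin 3) :
    Integrable
      (fun x : E3 => phi Γ μ δ x * fderiv ℝ (fun w : E3 => fderiv ℝ χ w (e3 j)) x (e3 i))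
      volume ∧
    Integrable (fun x : E3 => hessPhi Γ μ δ x i j * χ x) volume ∧
    ∫ x : E3, phi Γ μ δ x * fderiv ℝ (fun w : E3 => fderiv ℝ χ w (e3 j)) x (e3 i) =
      ∫ x : E3, hessPhi Γ μ δ x i j * χ x := by
  obtain ⟨hδ0, hδ1⟩ := hδ
  have hδ2 : δ ∈ Set.Icc (0 : ℝ) 2 := ⟨hδ0, by linarith⟩
  have phi_le (x : E3) : |phi Γ μ δ x| ≤ Γ * Afun μ δ ‖x‖ ^ (-(1 : ℝ) / 2) := by
    rw [phi_eq_mul_rpow, abs_of_nonneg]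
    unfold Afun
    positivity
  have int_phi : LocallyIntegrable (phi Γ μ δ) :=
    locallyIntegrable_of_abs_le_Afun_rpow (δ := δ) (k := 0) hμ hΓ.le (by norm_num; linarith) measurable_phi
      fun x _ => by simpa using phi_le x
  have int_phi_div : LocallyIntegrable fun x => phi Γ μ δ x * ‖x‖⁻¹ := by
    refine locallyIntegrable_of_abs_le_Afun_rpow (δ := δ) (k := 1) hμ hΓ.le (by norm_num; linarith)
      (measurable_phi.mul measurable_norm.inv) fun x _ => ?_
    rw [abs_mul, abs_of_nonneg (inv_nonneg.2 (norm_nonneg x)), pow_one]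
    gcongr
    exact phi_le x
  have int_grad : LocallyIntegrable fun x => gradPhi Γ μ δ x i :=
    locallyIntegrable_of_abs_le_Afun_rpow (δ := δ) (k := 1) hμ hΓ.le (by norm_num; linarith)
      (measurable_gradPhi i) fun x hx => by simpa using abs_gradPhi_le hΓ.le hμ hδ2 hx i
  have int_grad_div : LocallyIntegrable fun x => gradPhi Γ μ δ x i * ‖x‖⁻¹ := by
    refine locallyIntegrable_of_abs_le_Afun_rpow (δ := δ) (k := 2) hμ hΓ.le (by norm_num; linarith)
      ((measurable_gradPhi i).mul measurable_norm.inv) fun x hx => ?_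
    rw [abs_mul, abs_of_nonneg (inv_nonneg.2 (norm_nonneg x)), pow_two, mul_inv, ← mul_assoc]
    gcongr
    exact abs_gradPhi_le hΓ.le hμ hδ2 hx i
  have int_hess : LocallyIntegrable fun x => hessPhi Γ μ δ x i j :=
    locallyIntegrable_of_abs_le_Afun_rpow (δ := δ) (k := 2) hμ (by positivity) (by norm_num; linarith)
      (measurable_hessPhi i j) fun x hx => abs_hessPhi_le hΓ.le hμ hδ2 hx i j
  have hχ2 : ContDiff ℝ 2 χ := contDiff_infty.1 hχ 2
  have hχ1 : ContDiff ℝ 1 χ := hχ2.of_le one_le_two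
  have hdχ : ContDiff ℝ 1 fun w => fderiv ℝ χ w (e3 j) :=
    (hχ2.fderiv_right (by norm_num)).clm_apply contDiff_const
  have hdχs : HasCompactSupport fun w => fderiv ℝ χ w (e3 j) := hχsupp.fderiv_apply ℝ (e3 j)
  refine ⟨?_, ?_, ?_⟩
  · simpa using int_phi.integrable_smul_right_of_hasCompactSupport
      ((hdχ.continuous_fderiv one_ne_zero).clm_apply continuous_const)
      (hdχs.fderiv_apply ℝ (e3 i))
  · simpa using int_hess.integrable_smul_right_of_hasCompactSupport hχ.continuous hχsupp
  · rw [integral_mul_fderiv_eq_neg_of_hasLineDerivAt_off_zero int_phi int_phi_div int_grad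
        (fun x hx => hasLineDerivAt_phi hμ hx i) hdχ hdχs,
      integral_mul_fderiv_eq_neg_of_hasLineDerivAt_off_zero int_grad int_grad_div int_hess
        (fun x hx => hasLineDerivAt_gradPhi hμ hx i j) hχ1 hχsupp, neg_neg]
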